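/- For every index k with 1 ≤ k ≤ L−1 and every (t,α) ∈ ℝ × ℝ^{L−1}, the Christoffel symbol Γ^k_{00}(t,α) equals p_k(t) (A(t,α) C(t) − A'(t,α) B(t)) / (N(t) B(t) + A(t,α)²), where C(t) = Σ_{m=1}^{L−1} p_m'(t) p_m''(t) and A'(t,α) = w''(t) − Σ_{m=1}^{L−1} p_m''(t) α_m. -/

import Mathlib

/-!
Formalization of results from "A geometric approach to equilibrium selection":
the metric, Christoffel symbols and curvature of the equilibrium manifold of a
two-consumer exchange economy with `L` goods, parametrized by
`Φ(t,α) = (p_1(t),…,p_{L−1}(t), α_1,…,α_{L−1}, w(t) − Σ_m p_m(t) α_m)`.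

Indices run over `Fin L`, where the index `0` corresponds to the coordinate
`x_0 = t` and an index `i ≠ 0` corresponds to the coordinate `x_i = α_i`
(the component `α 0` of `α : Fin L → ℝ` is never used, so `α` is just a copy
of `ℝ^{L−1}` together with an irrelevant extra coordinate).
-/

open Matrix BigOperators

noncomputable section

namespace EqSelection

variable {L : ℕ}

/-- `A(t,α) = w'(t) − Σ_{m=1}^{L−1} p_m'(t) α_m`. -/
def eqA [NeZero L] (p : Fin L → ℝ → ℝ) (w : ℝ → ℝ) (t : ℝ) (α : Fin L → ℝ) : ℝ :=
  deriv w t - ∑ m ∈ Finset.univ \ {0}, deriv (p m) t * α m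

/-- `A'(t,α) = w''(t) − Σ_{m=1}^{L−1} p_m''(t) α_m`. -/
def eqA' [NeZero L] (p : Fin L → ℝ → ℝ) (w : ℝ → ℝ) (t : ℝ) (α : Fin L → ℝ) : ℝ :=
  deriv (deriv w) t - ∑ m ∈ Finset.univ \ {0}, deriv (deriv (p m)) t * α m

/-- `B(t) = Σ_{m=1}^{L−1} (p_m'(t))²`. -/
def eqB [NeZero L] (p : Fin L → ℝ → ℝ) (t : ℝ) : ℝ :=
  ∑ m ∈ Finset.univ \ {0}, (deriv (p m) t) ^ 2

/-- `N(t) = 1 + Σ_{m=1}^{L−1} (p_m(t))²`. -/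
def eqN [NeZero L] (p : Fin L → ℝ → ℝ) (t : ℝ) : ℝ :=
  1 + ∑ m ∈ Finset.univ \ {0}, (p m t) ^ 2

/-- `C(t) = Σ_{m=1}^{L−1} p_m'(t) p_m''(t)`. -/
def eqC [NeZero L] (p : Fin L → ℝ → ℝ) (t : ℝ) : ℝ :=
  ∑ m ∈ Finset.univ \ {0}, deriv (p m) t * deriv (deriv (p m)) t

/-- `P(t) = Σ_{m=1}^{L−1} p_m(t) p_m'(t)`. -/
def eqP [NeZero L] (p : Fin L → ℝ → ℝ) (t : ℝ) : ℝ :=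
  ∑ m ∈ Finset.univ \ {0}, p m t * deriv (p m) t

/-- The induced metric matrix `g(t,α)`: `g_{00} = B + A²`, `g_{0i} = g_{i0} = −p_i A`,
`g_{ij} = p_i p_j + δ_{ij}` for `i, j ≠ 0`. -/
def gMat [NeZero L] (p : Fin L → ℝ → ℝ) (w : ℝ → ℝ) (t : ℝ) (α : Fin L → ℝ) :
    Matrix (Fin L) (Fin L) ℝ :=
  Matrix.of fun i j =>
    if i = 0 then
      if j = 0 then eqB p t + (eqA p w t α) ^ 2 else -(p j t) * eqA p w t α
    else
      if j = 0 then -(p i t) * eqA p w t α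
      else p i t * p j t + (if i = j then 1 else 0)

/-- Partial derivative with respect to the coordinate `x_k`, where `x_0 = t`
and `x_i = α_i` for `i ≠ 0`. -/
def pder [NeZero L] (k : Fin L) (f : ℝ → (Fin L → ℝ) → ℝ) (t : ℝ) (α : Fin L → ℝ) : ℝ :=
  if k = 0 then deriv (fun s => f s α) t
  else deriv (fun s => f t (Function.update α k s)) (α k)

/-- Christoffel symbol
`Γ^k_{ij} = (1/2) Σ_{h=0}^{L−1} g^{hk} (∂g_{jh}/∂x_i + ∂g_{hi}/∂x_j − ∂g_{ij}/∂x_h)`,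
written `christoffel p w i j k`.  (Here `g^{hk}` denotes the entries of the inverse
matrix of `g`, i.e. of `(gMat p w t α)⁻¹`.) -/
def christoffel [NeZero L] (p : Fin L → ℝ → ℝ) (w : ℝ → ℝ) (i j k : Fin L)
    (t : ℝ) (α : Fin L → ℝ) : ℝ :=
  (1 / 2) * ∑ h : Fin L,
    (gMat p w t α)⁻¹ h k *
      (pder i (fun t' α' => gMat p w t' α' j h) t α
        + pder j (fun t' α' => gMat p w t' α' h i) t α
        - pder h (fun t' α' => gMat p w t' α' i j) t α)

/-- Curvature coefficient
`R^s_{ijk} = Σ_{m} Γ^m_{ik} Γ^s_{jm} − Σ_{m} Γ^m_{jk} Γ^s_{im} + ∂Γ^s_{ik}/∂x_j − ∂Γ^s_{jk}/∂x_i`,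
written `curvR p w i j k s`. -/
def curvR [NeZero L] (p : Fin L → ℝ → ℝ) (w : ℝ → ℝ) (i j k s : Fin L)
    (t : ℝ) (α : Fin L → ℝ) : ℝ :=
  (∑ m : Fin L, christoffel p w i k m t α * christoffel p w j m s t α)
    - (∑ m : Fin L, christoffel p w j k m t α * christoffel p w i m s t α)
    + pder j (christoffel p w i k s) t α - pder i (christoffel p w j k s) t α

/-- The coordinate tangent vectors `Φ_i(t,α) ∈ ℝ^{2L−1}` of the parametrization
`Φ(t,α) = (p_1(t),…,p_{L−1}(t), α_1,…,α_{L−1}, w(t) − Σ_m p_m(t) α_m)`: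
`Φ_0 = (p_1',…,p_{L−1}', 0,…,0, A)`, and for `i ≠ 0` the vector `Φ_i` has entry `1`
in position `(L−1)+i` (1-indexed), entry `−p_i` in the last position and `0` elsewhere. -/
def PhiVec [NeZero L] (p : Fin L → ℝ → ℝ) (w : ℝ → ℝ) (i : Fin L)
    (t : ℝ) (α : Fin L → ℝ) : Fin (2 * L - 1) → ℝ :=
  fun j =>
    if i = 0 then
      if h : (j : ℕ) < L - 1 then deriv (p ⟨(j : ℕ) + 1, by omega⟩) t
      else if (j : ℕ) = 2 * L - 2 then eqA p w t α else 0
    else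
      if (j : ℕ) + 1 = (L - 1) + (i : ℕ) then 1
      else if (j : ℕ) = 2 * L - 2 then -(p i t) else 0

/-- The matrix `M(t,α)` of Statement 2: `M_{00} = N`, `M_{0i} = M_{i0} = p_i A`,
`M_{ii} = (N − p_i²) B + A²`, `M_{ij} = −p_i p_j B` for `i ≠ j`, `i, j ≠ 0`. -/
def invNumer [NeZero L] (p : Fin L → ℝ → ℝ) (w : ℝ → ℝ) (t : ℝ) (α : Fin L → ℝ) :
    Matrix (Fin L) (Fin L) ℝ :=
  Matrix.of fun i j =>
    if i = 0 then
      if j = 0 then eqN p t else p j t * eqA p w t α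
    else
      if j = 0 then p i t * eqA p w t α
      else if i = j then (eqN p t - (p i t) ^ 2) * eqB p t + (eqA p w t α) ^ 2
      else -(p i t * p j t * eqB p t)

theorem sum_univ_eq_zero_add [NeZero L] (f : Fin L → ℝ) :
    ∑ h, f h = f 0 + ∑ h ∈ Finset.univ \ {0}, f h := by
  rw [add_comm, ← Finset.sum_sdiff (Finset.subset_univ {(0 : Fin L)}), Finset.sum_singleton]

theorem eqN_mul_eqB_add_sq_pos [NeZero L] (p : Fin L → ℝ → ℝ) (w : ℝ → ℝ) (t : ℝ)
    (α : Fin L → ℝ) (hreg : 0 < eqB p t ∨ deriv w t ≠ 0) :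
    0 < eqN p t * eqB p t + (eqA p w t α) ^ 2 := by
  have hN : 0 < eqN p t := by
    unfold eqN
    positivity
  have hB : 0 ≤ eqB p t := Finset.sum_nonneg fun _ _ => sq_nonneg _
  rcases hB.lt_or_eq with hB | hB
  · positivity
  · have hA : eqA p w t α = deriv w t := by
      have hz := (Finset.sum_eq_zero_iff_of_nonneg fun _ _ => sq_nonneg _).1 hB.symm
      rw [eqA, Finset.sum_eq_zero, sub_zero]
      intro m hm
      rw [pow_eq_zero_iff two_ne_zero |>.1 (hz m hm), zero_mul]
    have hw : deriv w t ≠ 0 := hreg.resolve_left (by rw [← hB]; exact lt_irrefl _)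
    rw [← hB, hA]
    positivity

theorem invNumer_apply_of_ne_zero [NeZero L] (p : Fin L → ℝ → ℝ) (w : ℝ → ℝ) (t : ℝ)
    (α : Fin L → ℝ) {i j : Fin L} (hi : i ≠ 0) (hj : j ≠ 0) :
    invNumer p w t α i j =
      (if i = j then eqN p t * eqB p t + (eqA p w t α) ^ 2 else 0)
        - p i t * p j t * eqB p t := by
  by_cases hij : i = j
  · subst hij
    simp only [invNumer, Matrix.of_apply, if_neg hi, if_true]
    ring
  · simp [invNumer, hi, hj, hij]

/-- Contraction of a column of `invNumer` with a covector whose `α`-part is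
proportional to `p`. -/
theorem sum_mul_invNumer [NeZero L] (p : Fin L → ℝ → ℝ) (w : ℝ → ℝ) (t : ℝ)
    (α : Fin L → ℝ) (a b : ℝ) (k : Fin L) :
    a * invNumer p w t α 0 k + ∑ h ∈ Finset.univ \ {0}, b * p h t * invNumer p w t α h k =
      if k = 0 then a * eqN p t + b * (eqN p t - 1) * eqA p w t α
      else p k t * (a * eqA p w t α + b * (eqB p t + (eqA p w t α) ^ 2)) := by
  have hS : ∑ m ∈ Finset.univ \ {0}, (p m t) ^ 2 = eqN p t - 1 := by
    rw [eqN]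
    ring
  split_ifs with hk
  · subst hk
    have hsum : ∑ h ∈ Finset.univ \ {0}, b * p h t * invNumer p w t α h 0 =
        ∑ h ∈ Finset.univ \ {0}, b * eqA p w t α * (p h t) ^ 2 := by
      refine Finset.sum_congr rfl fun h hh => ?_
      have hh0 : h ≠ 0 := by simpa using hh
      simp only [invNumer, Matrix.of_apply, if_neg hh0, if_true]
      ring
    rw [hsum, ← Finset.mul_sum, hS]
    simp only [invNumer, Matrix.of_apply, if_true]
    ring
  · have hsum : ∑ h ∈ Finset.univ \ {0}, b * p h t * invNumer p w t α h k =
        ∑ h ∈ Finset.univ \ {0},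
          ((if h = k then b * p k t * (eqN p t * eqB p t + (eqA p w t α) ^ 2) else 0)
            - b * p k t * eqB p t * (p h t) ^ 2) := by
      refine Finset.sum_congr rfl fun h hh => ?_
      have hh0 : h ≠ 0 := by simpa using hh
      rw [invNumer_apply_of_ne_zero p w t α hh0 hk]
      split_ifs with hhk
      · subst hhk
        ring
      · ring
    rw [hsum, Finset.sum_sub_distrib, ← Finset.mul_sum, hS, Finset.sum_ite_eq',
      if_pos (by simpa using hk)]
    simp only [invNumer, Matrix.of_apply, if_neg hk, if_true]
    ring

theorem gMat_mul_invNumer [NeZero L] (p : Fin L → ℝ → ℝ) (w : ℝ → ℝ) (t : ℝ)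
    (α : Fin L → ℝ) :
    gMat p w t α * invNumer p w t α =
      (eqN p t * eqB p t + (eqA p w t α) ^ 2) • (1 : Matrix (Fin L) (Fin L) ℝ) := by
  ext i k
  rw [Matrix.mul_apply, sum_univ_eq_zero_add, Matrix.smul_apply, Matrix.one_apply, smul_eq_mul]
  by_cases hi : i = 0
  · subst hi
    have hsum : ∑ h ∈ Finset.univ \ {0}, gMat p w t α 0 h * invNumer p w t α h k =
        ∑ h ∈ Finset.univ \ {0}, -eqA p w t α * p h t * invNumer p w t α h k := by
      refine Finset.sum_congr rfl fun h hh => ?_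
      have hh0 : h ≠ 0 := by simpa using hh
      simp only [gMat, Matrix.of_apply, if_neg hh0, if_true]
      ring
    rw [hsum, sum_mul_invNumer]
    by_cases hk : k = 0
    · subst hk
      simp only [gMat, Matrix.of_apply, if_true]
      ring
    · simp only [gMat, Matrix.of_apply, if_true, if_neg hk, if_neg (Ne.symm hk)]
      ring
  · have hsum : ∑ h ∈ Finset.univ \ {0}, gMat p w t α i h * invNumer p w t α h k =
        ∑ h ∈ Finset.univ \ {0}, (p i t * p h t * invNumer p w t α h k
          + if i = h then invNumer p w t α i k else 0) := by
      refine Finset.sum_congr rfl fun h hh => ?_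
      have hh0 : h ≠ 0 := by simpa using hh
      simp only [gMat, Matrix.of_apply, if_neg hh0, if_neg hi]
      split_ifs with hih
      · subst hih
        ring
      · ring
    rw [hsum, Finset.sum_add_distrib, ← add_assoc, sum_mul_invNumer, Finset.sum_ite_eq,
      if_pos (show i ∈ Finset.univ \ {0} by simpa using hi)]
    by_cases hk : k = 0
    · subst hk
      simp only [gMat, invNumer, Matrix.of_apply, if_true, if_neg hi]
      ring
    · rw [invNumer_apply_of_ne_zero p w t α hi hk]
      simp only [gMat, Matrix.of_apply, if_true, if_neg hi, if_neg hk]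
      split_ifs <;> ring

theorem gMat_inv [NeZero L] (p : Fin L → ℝ → ℝ) (w : ℝ → ℝ) (t : ℝ) (α : Fin L → ℝ)
    (hD : eqN p t * eqB p t + (eqA p w t α) ^ 2 ≠ 0) :
    (gMat p w t α)⁻¹ =
      (eqN p t * eqB p t + (eqA p w t α) ^ 2)⁻¹ • invNumer p w t α := by
  refine Matrix.inv_eq_right_inv ?_
  rw [Matrix.mul_smul, gMat_mul_invNumer, smul_smul, inv_mul_cancel₀ hD, one_smul]

theorem hasDerivAt_deriv_of_contDiff {f : ℝ → ℝ} (hf : ContDiff ℝ (⊤ : ℕ∞) f) (t : ℝ) :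
    HasDerivAt (deriv f) (deriv (deriv f) t) t :=
  ((contDiff_infty_iff_deriv.1 hf).2.differentiable (by simp) t).hasDerivAt

theorem hasDerivAt_eqA [NeZero L] {p : Fin L → ℝ → ℝ} {w : ℝ → ℝ}
    (hp : ∀ i, ContDiff ℝ (⊤ : ℕ∞) (p i)) (hw : ContDiff ℝ (⊤ : ℕ∞) w)
    (t : ℝ) (α : Fin L → ℝ) :
    HasDerivAt (fun s => eqA p w s α) (eqA' p w t α) t :=
  (hasDerivAt_deriv_of_contDiff hw t).sub <|
    HasDerivAt.fun_sum fun m _ => (hasDerivAt_deriv_of_contDiff (hp m) t).mul_const _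

theorem hasDerivAt_eqB [NeZero L] {p : Fin L → ℝ → ℝ}
    (hp : ∀ i, ContDiff ℝ (⊤ : ℕ∞) (p i)) (t : ℝ) :
    HasDerivAt (eqB p) (2 * eqC p t) t := by
  have h := HasDerivAt.fun_sum (u := Finset.univ \ {(0 : Fin L)}) fun m _ =>
    (hasDerivAt_deriv_of_contDiff (hp m) t).fun_pow 2
  refine h.congr_deriv ?_
  rw [eqC, Finset.mul_sum]
  refine Finset.sum_congr rfl fun m _ => ?_
  push_cast
  ring

theorem hasDerivAt_eqA_update [NeZero L] (p : Fin L → ℝ → ℝ) (w : ℝ → ℝ) (t : ℝ)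
    (α : Fin L → ℝ) {h : Fin L} (hh : h ≠ 0) :
    HasDerivAt (fun s => eqA p w t (Function.update α h s)) (-deriv (p h) t) (α h) := by
  have hsum := HasDerivAt.fun_sum (u := Finset.univ \ {(0 : Fin L)}) fun m _ =>
    (hasDerivAt_pi.1 (hasDerivAt_update α h (α h)) m).const_mul (deriv (p m) t)
  refine (hsum.const_sub (deriv w t)).congr_deriv ?_
  simp [Pi.single_apply, hh]

theorem pder_zero_gMat_zero_zero [NeZero L] {p : Fin L → ℝ → ℝ} {w : ℝ → ℝ}
    (hp : ∀ i, ContDiff ℝ (⊤ : ℕ∞) (p i)) (hw : ContDiff ℝ (⊤ : ℕ∞) w)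
    (t : ℝ) (α : Fin L → ℝ) :
    pder 0 (fun t' α' => gMat p w t' α' 0 0) t α =
      2 * (eqC p t + eqA p w t α * eqA' p w t α) := by
  have h := (hasDerivAt_eqB hp t).fun_add ((hasDerivAt_eqA hp hw t α).fun_pow 2)
  simp only [pder, gMat, Matrix.of_apply, if_true]
  rw [h.deriv]
  push_cast
  ring

theorem pder_gMat_zero_zero_of_ne_zero [NeZero L] (p : Fin L → ℝ → ℝ) (w : ℝ → ℝ)
    (t : ℝ) (α : Fin L → ℝ) {h : Fin L} (hh : h ≠ 0) :
    pder h (fun t' α' => gMat p w t' α' 0 0) t α = -2 * eqA p w t α * deriv (p h) t := by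
  have hd := ((hasDerivAt_eqA_update p w t α hh).fun_pow 2).const_add (eqB p t)
  simp only [pder, gMat, Matrix.of_apply, if_true, if_neg hh]
  rw [hd.deriv, Function.update_eq_self]
  push_cast
  ring

theorem pder_zero_gMat_zero_of_ne_zero [NeZero L] {p : Fin L → ℝ → ℝ} {w : ℝ → ℝ}
    (hp : ∀ i, ContDiff ℝ (⊤ : ℕ∞) (p i)) (hw : ContDiff ℝ (⊤ : ℕ∞) w)
    (t : ℝ) (α : Fin L → ℝ) {h : Fin L} (hh : h ≠ 0) :
    pder 0 (fun t' α' => gMat p w t' α' 0 h) t α =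
      -(deriv (p h) t * eqA p w t α + p h t * eqA' p w t α) := by
  have hd := (((hp h).differentiable (by simp) t).hasDerivAt.fun_neg).fun_mul
    (hasDerivAt_eqA hp hw t α)
  simp only [pder, gMat, Matrix.of_apply, if_true, if_neg hh]
  rw [hd.deriv]
  ring

theorem gMat_symm [NeZero L] (p : Fin L → ℝ → ℝ) (w : ℝ → ℝ) (t : ℝ) (α : Fin L → ℝ)
    (i j : Fin L) : gMat p w t α i j = gMat p w t α j i := by
  simp only [gMat, Matrix.of_apply, mul_comm (p i t) (p j t), eq_comm (a := i) (b := j)]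
  split_ifs <;> simp_all

theorem statement_9 (L : ℕ) [NeZero L] (hL : 2 ≤ L)
    (p : Fin L → ℝ → ℝ) (w : ℝ → ℝ)
    (hp : ∀ i, ContDiff ℝ (⊤ : ℕ∞) (p i)) (hw : ContDiff ℝ (⊤ : ℕ∞) w)
    (hreg : ∀ t : ℝ, 0 < eqB p t ∨ deriv w t ≠ 0) :
    ∀ k : Fin L, k ≠ 0 →
      ∀ (t : ℝ) (α : Fin L → ℝ),
        christoffel p w 0 0 k t α
          = p k t * (eqA p w t α * eqC p t - eqA' p w t α * eqB p t) / (eqN p t * eqB p t + (eqA p w t α) ^ 2) := by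
  intro k hk t α
  have hD := (eqN_mul_eqB_add_sq_pos p w t α (hreg t)).ne'
  have hsum : ∑ h ∈ Finset.univ \ {0}, (gMat p w t α)⁻¹ h k *
      (pder 0 (fun t' α' => gMat p w t' α' 0 h) t α
        + pder 0 (fun t' α' => gMat p w t' α' 0 h) t α
        - pder h (fun t' α' => gMat p w t' α' 0 0) t α) =
      2 * (eqN p t * eqB p t + (eqA p w t α) ^ 2)⁻¹ *
        ∑ h ∈ Finset.univ \ {0}, -eqA' p w t α * p h t * invNumer p w t α h k := by
    rw [Finset.mul_sum]
    refine Finset.sum_congr rfl fun h hh => ?_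
    have hh0 : h ≠ 0 := by simpa using hh
    rw [pder_zero_gMat_zero_of_ne_zero hp hw t α hh0,
      pder_gMat_zero_zero_of_ne_zero p w t α hh0, gMat_inv p w t α hD, Matrix.smul_apply,
      smul_eq_mul]
    ring
  have hcol := sum_mul_invNumer p w t α (eqC p t + eqA p w t α * eqA' p w t α)
    (-eqA' p w t α) k
  rw [if_neg hk] at hcol
  simp only [christoffel, gMat_symm p w _ _ _ 0]
  simp only [sum_univ_eq_zero_add, hsum, pder_zero_gMat_zero_zero hp hw]
  rw [eq_sub_of_add_eq' hcol, gMat_inv p w t α hD, Matrix.smul_apply, smul_eq_mul]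
  field_simp
  ring

end EqSelection
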